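/- Let α > −1, let q ≥ 0 be an integer, and let n ≥ 2 be an integer. Then P_{2n}^{α,q} and P_{2n−2}^{α+1,q+1} each have only real zeros, and the largest zero of P_{2n−2}^{α+1,q+1} is strictly smaller than the largest zero of P_{2n}^{α,q}. -/

import Mathlib

open MeasureTheory intervalIntegral Polynomial

/-- Pochhammer symbol `(a)_k = a (a+1) ⋯ (a+k-1)`. -/
noncomputable def poch (a : ℝ) (k : ℕ) : ℝ := ∏ i ∈ Finset.range k, (a + i)

/-- `Peven α q n x = P_{2n}^{α,q}(x)`, the monic generalized Gegenbauer-type polynomial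
`Σ_{k=0}^{n} (−n)_k (−n−q−1/2)_k / (k! (−2n−α−q−1/2)_k) x^{2n−2k}`. -/
noncomputable def Peven (α : ℝ) (q n : ℕ) (x : ℝ) : ℝ :=
  ∑ k ∈ Finset.range (n + 1),
    poch (-(n : ℝ)) k * poch (-(n : ℝ) - q - 1/2) k /
      ((Nat.factorial k : ℝ) * poch (-(2 * (n : ℝ)) - α - q - 1/2) k) * x ^ (2*n - 2*k)

/-- `Podd α q n x = P_{2n+1}^{α,q}(x) = (1+x) P_{2n}^{α+1,q}(x)`. -/
noncomputable def Podd (α : ℝ) (q n : ℕ) (x : ℝ) : ℝ := (1 + x) * Peven (α + 1) q n x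

/-- `P α q n x = P_n^{α,q}(x)`. -/
noncomputable def P (α : ℝ) (q : ℕ) (n : ℕ) (x : ℝ) : ℝ :=
  if Even n then Peven α q (n / 2) x else Podd α q (n / 2) x

lemma poch_succ (a : ℝ) (k : ℕ) : poch a (k + 1) = poch a k * (a + k) :=
  Finset.prod_range_succ _ _

lemma poch_succ_left (a : ℝ) (k : ℕ) : poch a (k + 1) = a * poch (a + 1) k := by
  unfold poch
  rw [Finset.prod_range_succ', mul_comm]
  congr 1
  · simp
  · refine Finset.prod_congr rfl fun i _ => ?_
    push_cast
    ring

/-- The coefficient of `X ^ (n - k)` in the monic Jacobi polynomial on `[0, 1]`. -/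
noncomputable def jacobiCoeff (α β : ℝ) (n k : ℕ) : ℝ :=
  poch (-(n : ℝ)) k * poch (-(n : ℝ) - β) k /
    ((Nat.factorial k : ℝ) * poch (-(2 * (n : ℝ)) - α - β) k)

/-- The monic Jacobi polynomial of degree `n` for the weight `(1 - y) ^ α * y ^ β` on `[0, 1]`. -/
noncomputable def jacobi (α β : ℝ) (n : ℕ) : ℝ[X] :=
  ∑ k ∈ Finset.range (n + 1), monomial (n - k) (jacobiCoeff α β n k)

lemma poch_denom_ne_zero {α β : ℝ} (hα : -1 < α) (hβ : -1 < β) {n k : ℕ} (hk : k ≤ n) :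
    poch (-(2 * (n : ℝ)) - α - β) k ≠ 0 := by
  refine Finset.prod_ne_zero_iff.mpr fun i hi => ne_of_lt ?_
  have h : ((i + 1 : ℕ) : ℝ) ≤ n := by
    exact_mod_cast (Nat.succ_le_of_lt (Finset.mem_range.mp hi)).trans hk
  have h' : ((1 : ℕ) : ℝ) ≤ n := by
    exact_mod_cast (Nat.succ_le_of_lt (i.zero_le.trans_lt (Finset.mem_range.mp hi))).trans hk
  push_cast at h h'
  linarith

lemma jacobiCoeff_zero (α β : ℝ) (n : ℕ) : jacobiCoeff α β n 0 = 1 := by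
  simp [jacobiCoeff, poch]

lemma jacobiCoeff_succ {α β : ℝ} (hα : -1 < α) (hβ : -1 < β) {n k : ℕ} (hk : k < n) :
    jacobiCoeff α β n (k + 1) * ((k + 1) * (-(2 * (n : ℝ)) - α - β + k)) =
      jacobiCoeff α β n k * ((-n + k) * (-n - β + k)) := by
  have h₁ := poch_denom_ne_zero hα hβ (Nat.succ_le_of_lt hk)
  unfold jacobiCoeff
  rw [poch_succ] at h₁
  have h₂ := left_ne_zero_of_mul h₁
  have h₃ := right_ne_zero_of_mul h₁
  have h₄ : (Nat.factorial k : ℝ) ≠ 0 := by exact_mod_cast Nat.factorial_ne_zero k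
  have h₅ : (k + 1 : ℝ) ≠ 0 := by positivity
  simp only [poch_succ, Nat.factorial_succ]
  push_cast
  generalize poch (-(2 * (n : ℝ)) - α - β) k = d at h₂ ⊢
  generalize -(2 * (n : ℝ)) - α - β + k = e at h₃ ⊢
  field_simp

lemma jacobiCoeff_shift (α β : ℝ) (n k : ℕ) :
    ((n : ℝ) + 1) * jacobiCoeff (α + 1) (β + 1) n k =
      ((n : ℝ) + 1 - k) * jacobiCoeff α β (n + 1) k := by
  have h : ((n : ℝ) + 1) * poch (-(n : ℝ)) k =
      ((n : ℝ) + 1 - k) * poch (-((n + 1 : ℕ) : ℝ)) k := by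
    have h₁ := poch_succ (-((n + 1 : ℕ) : ℝ)) k
    have h₂ := poch_succ_left (-((n + 1 : ℕ) : ℝ)) k
    have h₃ : -((n + 1 : ℕ) : ℝ) + 1 = -(n : ℝ) := by push_cast; ring
    rw [h₃, h₁] at h₂
    push_cast at h₂ ⊢
    linarith
  have h₁ : -(n : ℝ) - (β + 1) = -((n + 1 : ℕ) : ℝ) - β := by push_cast; ring
  have h₂ : -(2 * (n : ℝ)) - (α + 1) - (β + 1) = -(2 * ((n + 1 : ℕ) : ℝ)) - α - β := by
    push_cast; ring
  unfold jacobiCoeff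
  rw [h₁, h₂, ← mul_div_assoc, ← mul_div_assoc, ← mul_assoc, ← mul_assoc, h]

lemma jacobi_coeff (α β : ℝ) (n j : ℕ) :
    (jacobi α β n).coeff j = if j ≤ n then jacobiCoeff α β n (n - j) else 0 := by
  unfold jacobi
  simp only [finsetSum_coeff, coeff_monomial]
  split_ifs with h
  · rw [Finset.sum_eq_single (n - j)]
    · rw [if_pos (by omega)]
    · intro k hk hne
      rw [Finset.mem_range] at hk
      rw [if_neg (by omega)]
    · intro hk
      rw [Finset.mem_range] at hk
      omega
  · refine Finset.sum_eq_zero fun k _ => if_neg (by omega)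

lemma jacobi_natDegree_le (α β : ℝ) (n : ℕ) : (jacobi α β n).natDegree ≤ n :=
  natDegree_le_iff_coeff_eq_zero.mpr fun j hj => by rw [jacobi_coeff, if_neg (by omega)]

lemma jacobi_monic (α β : ℝ) (n : ℕ) : (jacobi α β n).Monic :=
  monic_of_natDegree_le_of_coeff_eq_one n (jacobi_natDegree_le α β n)
    (by simp [jacobi_coeff, jacobiCoeff_zero])

lemma derivative_jacobi (α β : ℝ) (n : ℕ) :
    derivative (jacobi α β (n + 1)) = C ((n : ℝ) + 1) * jacobi (α + 1) (β + 1) n := by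
  ext j
  rw [coeff_derivative, coeff_C_mul, jacobi_coeff, jacobi_coeff]
  by_cases h : j ≤ n
  · rw [if_pos h, if_pos (by omega), jacobiCoeff_shift, show n + 1 - (j + 1) = n - j by omega,
      Nat.cast_sub h]
    ring
  · rw [if_neg h, if_neg (by omega)]
    simp

lemma jacobi_coeff_recurrence {α β : ℝ} (hα : -1 < α) (hβ : -1 < β) (n j : ℕ) :
    ((j : ℝ) + 1) * (j + β + 1) * (jacobi α β n).coeff (j + 1) =
      -((n : ℝ) - j) * (n + j + α + β + 1) * (jacobi α β n).coeff j := by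
  rw [jacobi_coeff, jacobi_coeff]
  rcases lt_trichotomy j n with h | rfl | h
  · rw [if_pos (Nat.succ_le_of_lt h), if_pos h.le]
    obtain ⟨k, rfl⟩ : ∃ k, n = j + 1 + k := ⟨n - (j + 1), by omega⟩
    rw [show j + 1 + k - (j + 1) = k by omega, show j + 1 + k - j = k + 1 by omega]
    have := jacobiCoeff_succ hα hβ (n := j + 1 + k) (k := k) (by omega)
    push_cast at this ⊢
    linear_combination -this
  · simp
  · rw [if_neg (by omega), if_neg (by omega)]
    simp

/-- The hypergeometric differential equation satisfied by the Jacobi polynomials. -/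
lemma jacobi_ode {α β : ℝ} (hα : -1 < α) (hβ : -1 < β) (n : ℕ) :
    X * (1 - X) * derivative (derivative (jacobi α β n)) +
      (C (β + 1) - C (α + β + 2) * X) * derivative (jacobi α β n) =
      C (-((n : ℝ) * (n + α + β + 1))) * jacobi α β n := by
  have key := jacobi_coeff_recurrence hα hβ n
  generalize jacobi α β n = p at key ⊢
  have hp : X * (1 - X) * derivative (derivative p) +
      (C (β + 1) - C (α + β + 2) * X) * derivative p =
      X * derivative (derivative p) - X * (X * derivative (derivative p)) +
        C (β + 1) * derivative p - C (α + β + 2) * (X * derivative p) := by ring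
  rw [hp]
  ext j
  have hj := key j
  rcases j with _ | _ | j
  · simp [coeff_derivative] at hj ⊢
    linear_combination hj
  · simp only [coeff_add, coeff_sub, coeff_C_mul, coeff_X_mul, coeff_derivative,
      coeff_X_mul_zero] at hj ⊢
    push_cast at hj ⊢
    linear_combination hj
  · simp only [coeff_add, coeff_sub, coeff_C_mul, coeff_X_mul, coeff_derivative] at hj ⊢
    push_cast at hj ⊢
    linear_combination hj

lemma hasDerivAt_weight_mul_derivative_jacobi {α β : ℝ} (hα : -1 < α) (hβ : -1 < β) (n : ℕ)
    {y : ℝ} (hy : y ∈ Set.Ioo (0 : ℝ) 1) :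
    HasDerivAt
      (fun t : ℝ => t ^ (β + 1) * (1 - t) ^ (α + 1) * (derivative (jacobi α β n)).eval t)
      (y ^ β * (1 - y) ^ α * (-((n : ℝ) * (n + α + β + 1)) * (jacobi α β n).eval y)) y := by
  have hy₀ := hy.1
  have hy₁ : 0 < 1 - y := sub_pos.mpr hy.2
  have h₁ : HasDerivAt (fun t : ℝ => t ^ (β + 1)) ((β + 1) * y ^ β) y := by
    simpa using Real.hasDerivAt_rpow_const (p := β + 1) (Or.inl hy₀.ne')
  have h₂ : HasDerivAt (fun t : ℝ => (1 - t) ^ (α + 1)) (-((α + 1) * (1 - y) ^ α)) y := by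
    refine (((hasDerivAt_id y).const_sub 1).rpow_const (p := α + 1)
      (Or.inl hy₁.ne')).congr_deriv ?_
    rw [add_sub_cancel_right, id]
    ring
  have h₃ := (derivative (jacobi α β n)).hasDerivAt y
  refine ((h₁.mul h₂).mul h₃).congr_deriv ?_
  have ode := congrArg (eval y) (jacobi_ode hα hβ n)
  simp only [eval_add, eval_sub, eval_mul, eval_C, eval_X, eval_one] at ode
  simp only [Pi.mul_apply]
  rw [← ode, Real.rpow_add_one hy₀.ne', Real.rpow_add_one hy₁.ne']
  ring

/-- Consecutive zeros of `y ^ (β + 1) * (1 - y) ^ (α + 1) * p'` enclose a zero of `p`. -/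
lemma exists_jacobi_root_between {α β : ℝ} (hα : -1 < α) (hβ : -1 < β) {n : ℕ} (hn : n ≠ 0)
    {x y : ℝ} (hx : 0 ≤ x) (hy : y ≤ 1) (hxy : x < y)
    (hfx : x ^ (β + 1) * (1 - x) ^ (α + 1) * (derivative (jacobi α β n)).eval x = 0)
    (hfy : y ^ (β + 1) * (1 - y) ^ (α + 1) * (derivative (jacobi α β n)).eval y = 0) :
    ∃ z ∈ Set.Ioo x y, (jacobi α β n).IsRoot z := by
  have hcont : Continuous
      (fun t : ℝ => t ^ (β + 1) * (1 - t) ^ (α + 1) * (derivative (jacobi α β n)).eval t) := by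
    refine (Continuous.mul ?_ ?_).mul (Polynomial.continuous _)
    · exact Real.continuous_rpow_const (by linarith)
    · exact (Real.continuous_rpow_const (by linarith)).comp (continuous_const.sub continuous_id)
  obtain ⟨z, hz, hz'⟩ := exists_hasDerivAt_eq_zero hxy hcont.continuousOn (hfx.trans hfy.symm)
    fun t ht => hasDerivAt_weight_mul_derivative_jacobi hα hβ n
      ⟨hx.trans_lt ht.1, ht.2.trans_le hy⟩
  refine ⟨z, hz, ?_⟩
  have h₁ : 0 < z ^ β := Real.rpow_pos_of_pos (hx.trans_lt hz.1) _
  have h₂ : 0 < (1 - z) ^ α := Real.rpow_pos_of_pos (by linarith [hz.2]) _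
  have h₃ : (1 : ℝ) ≤ n := by exact_mod_cast Nat.one_le_iff_ne_zero.mpr hn
  have h₄ : 0 < (n : ℝ) * (n + α + β + 1) := mul_pos (by linarith) (by linarith)
  rcases mul_eq_zero.mp hz' with h | h
  · exact absurd h (mul_pos h₁ h₂).ne'
  · exact (mul_eq_zero.mp h).resolve_left (neg_ne_zero.mpr h₄.ne')

lemma exists_jacobi_roots {α β : ℝ} (hα : -1 < α) (hβ : -1 < β) (n : ℕ) :
    ∃ F : Finset ℝ, F.card = n ∧ ∀ r ∈ F, r ∈ Set.Ioo (0 : ℝ) 1 ∧ (jacobi α β n).IsRoot r := by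
  classical
  induction n generalizing α β with
  | zero => exact ⟨∅, rfl, by simp⟩
  | succ n ih =>
    obtain ⟨F, hF, hF'⟩ := ih (α := α + 1) (β := β + 1) (by linarith) (by linarith)
    have h0 : (0 : ℝ) ∉ F := fun h => (hF' 0 h).1.1.ne rfl
    have h1 : (1 : ℝ) ∉ F := fun h => (hF' 1 h).1.2.ne rfl
    set s : Finset ℝ := insert 0 (insert 1 F) with hs
    set t : Finset ℝ := (jacobi α β (n + 1)).roots.toFinset.filter (· ∈ Set.Ioo (0 : ℝ) 1) with ht
    have hmem : ∀ x ∈ s, x ∈ Set.Icc (0 : ℝ) 1 ∧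
        x ^ (β + 1) * (1 - x) ^ (α + 1) * (derivative (jacobi α β (n + 1))).eval x = 0 := by
      intro x hx
      simp only [hs, Finset.mem_insert] at hx
      rcases hx with rfl | rfl | hx
      · simp [Real.zero_rpow (by linarith : β + 1 ≠ 0)]
      · simp [Real.zero_rpow (by linarith : α + 1 ≠ 0)]
      · refine ⟨Set.Ioo_subset_Icc_self (hF' x hx).1, ?_⟩
        rw [derivative_jacobi, eval_mul, (hF' x hx).2.eq_zero, mul_zero, mul_zero]
    have hcard : s.card ≤ t.card + 1 := by
      refine Finset.card_le_of_interleaved fun x hx y hy hxy _ => ?_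
      obtain ⟨z, hz, hz'⟩ := exists_jacobi_root_between hα hβ n.succ_ne_zero (hmem x hx).1.1
        (hmem y hy).1.2 hxy (hmem x hx).2 (hmem y hy).2
      refine ⟨z, ?_, hz.1, hz.2⟩
      rw [ht, Finset.mem_filter, Multiset.mem_toFinset, mem_roots (jacobi_monic _ _ _).ne_zero]
      exact ⟨hz', (hmem x hx).1.1.trans_lt hz.1, hz.2.trans_le (hmem y hy).1.2⟩
    rw [hs, Finset.card_insert_of_notMem (by simp [h0]), Finset.card_insert_of_notMem h1, hF]
      at hcard
    obtain ⟨G, hG, hG'⟩ := Finset.exists_subset_card_eq (s := t) (n := n + 1) (by omega)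
    refine ⟨G, hG', fun r hr => ?_⟩
    have := hG hr
    rw [ht, Finset.mem_filter, Multiset.mem_toFinset,
      mem_roots (jacobi_monic _ _ _).ne_zero] at this
    exact this.symm

/-- The Jacobi polynomials split with simple roots in `(0, 1)`. -/
lemma exists_jacobi_eq_prod {α β : ℝ} (hα : -1 < α) (hβ : -1 < β) (n : ℕ) :
    ∃ F : Finset ℝ, F.card = n ∧ (∀ r ∈ F, 0 < r) ∧ jacobi α β n = ∏ r ∈ F, (X - C r) := by
  classical
  obtain ⟨F, hF, hF'⟩ := exists_jacobi_roots hα hβ n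
  refine ⟨F, hF, fun r hr => (hF' r hr).1.1, ?_⟩
  have hdvd : ∏ r ∈ F, (X - C r) ∣ jacobi α β n :=
    Finset.prod_dvd_of_coprime
      (fun a _ b _ hab => pairwise_coprime_X_sub_C Function.injective_id hab)
      fun r hr => dvd_iff_isRoot.mpr (hF' r hr).2
  refine (eq_of_monic_of_dvd_of_natDegree_le (monic_prod_X_sub_C _ _) (jacobi_monic α β n) hdvd
    ?_)
  rw [natDegree_finsetProd_X_sub_C_eq_card, hF]
  exact jacobi_natDegree_le α β n

lemma Peven_eq_eval_jacobi (α : ℝ) (q n : ℕ) (x : ℝ) :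
    Peven α q n x = (jacobi α (q + 1 / 2) n).eval (x ^ 2) := by
  unfold Peven jacobi
  rw [eval_finsetSum]
  refine Finset.sum_congr rfl fun k _ => ?_
  rw [eval_monomial, jacobiCoeff, ← pow_mul, Nat.mul_sub, sub_add_eq_sub_sub, sub_add_eq_sub_sub]

/-- A product of distinct linear factors has nonvanishing derivative from its largest root on. -/
lemma derivative_prod_pos {F : Finset ℝ} {m g : ℝ} (hm : m ∈ F) (hmax : ∀ r ∈ F, r ≤ m)
    (hg : m ≤ g) : 0 < (derivative (∏ r ∈ F, (X - C r))).eval g := by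
  classical
  rw [derivative_prod_finset, eval_finsetSum]
  refine Finset.sum_pos' (fun r _ => ?_) ⟨m, hm, ?_⟩
  · simp only [derivative_X_sub_C, mul_one, eval_prod, eval_sub, eval_X, eval_C]
    exact Finset.prod_nonneg fun i hi =>
      sub_nonneg.mpr ((hmax i (Finset.mem_of_mem_erase hi)).trans hg)
  · simp only [derivative_X_sub_C, mul_one, eval_prod, eval_sub, eval_X, eval_C]
    refine Finset.prod_pos fun i hi => sub_pos.mpr (lt_of_lt_of_le ?_ hg)
    exact lt_of_le_of_ne (hmax i (Finset.mem_of_mem_erase hi)) (Finset.ne_of_mem_erase hi)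

/-- The square roots, of both signs, of the elements of `F`. -/
noncomputable def signedSqrts (F : Finset ℝ) : Multiset ℝ :=
  F.val.map Real.sqrt + F.val.map fun r => -Real.sqrt r

lemma card_signedSqrts (F : Finset ℝ) : Multiset.card (signedSqrts F) = 2 * F.card := by
  simp [signedSqrts, two_mul]

lemma sqrt_mem_signedSqrts {F : Finset ℝ} {m : ℝ} (hm : m ∈ F) : √m ∈ signedSqrts F :=
  Multiset.mem_add.mpr (Or.inl (Multiset.mem_map_of_mem _ hm))

lemma le_sqrt_of_mem_signedSqrts {F : Finset ℝ} {m t : ℝ} (hmax : ∀ r ∈ F, r ≤ m)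
    (ht : t ∈ signedSqrts F) : t ≤ √m := by
  rcases Multiset.mem_add.mp ht with h | h <;> obtain ⟨r, hr, rfl⟩ := Multiset.mem_map.mp h
  · exact Real.sqrt_le_sqrt (hmax r hr)
  · exact (neg_nonpos.mpr (Real.sqrt_nonneg r)).trans (Real.sqrt_nonneg m)

lemma prod_signedSqrts {F : Finset ℝ} (hF : ∀ r ∈ F, 0 < r) (x : ℝ) :
    ((signedSqrts F).map fun s => x - s).prod = (∏ r ∈ F, (X - C r)).eval (x ^ 2) := by
  rw [signedSqrts, Multiset.map_add, Multiset.prod_add, Multiset.map_map, Multiset.map_map]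
  change (∏ r ∈ F, (x - √r)) * (∏ r ∈ F, (x - -√r)) = _
  rw [← Finset.prod_mul_distrib, eval_prod]
  refine Finset.prod_congr rfl fun r hr => ?_
  rw [eval_sub, eval_X, eval_C]
  linear_combination -Real.sq_sqrt (hF r hr).le

/-- `P_{2n}^{α,q}` and `P_{2n−2}^{α+1,q+1}` have only real zeros (they split into real
linear factors), and the largest zero of `P_{2n−2}^{α+1,q+1}` is strictly smaller than the
largest zero of `P_{2n}^{α,q}`. -/
theorem largest_zero_monotone_step (α : ℝ) (hα : -1 < α) (q : ℕ) (n : ℕ) (hn : 2 ≤ n) :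
    ∃ S T : Multiset ℝ,
      Multiset.card S = 2 * n ∧ Multiset.card T = 2 * (n - 1) ∧
      (∀ x : ℝ, Peven α q n x = (S.map (fun s => x - s)).prod) ∧
      (∀ x : ℝ, Peven (α + 1) (q + 1) (n - 1) x = (T.map (fun s => x - s)).prod) ∧
      ∃ a b : ℝ, a ∈ T ∧ b ∈ S ∧ (∀ t ∈ T, t ≤ a) ∧ (∀ t ∈ S, t ≤ b) ∧ a < b := by
  obtain ⟨m, rfl⟩ : ∃ m, n = m + 1 := ⟨n - 1, by omega⟩
  have hβ : (-1 : ℝ) < q + 1 / 2 := neg_one_lt_zero.trans (by positivity)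
  rw [Nat.add_sub_cancel]
  obtain ⟨F, hF, hFpos, hFprod⟩ := exists_jacobi_eq_prod hα hβ (m + 1)
  obtain ⟨G, hG, hGpos, hGprod⟩ := exists_jacobi_eq_prod (α := α + 1) (β := q + 1 / 2 + 1)
    (by linarith) (by linarith) m
  have hFne : F.Nonempty := Finset.card_pos.mp (by omega)
  have hGne : G.Nonempty := Finset.card_pos.mp (by omega)
  obtain ⟨b, hb, hbmax⟩ := F.exists_max_image id hFne
  obtain ⟨a, ha, hamax⟩ := G.exists_max_image id hGne
  have hab : a < b := by
    by_contra! h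
    have hpos := derivative_prod_pos hb hbmax h
    rw [← hFprod, derivative_jacobi, hGprod, eval_mul, eval_prod,
      Finset.prod_eq_zero ha (by simp), mul_zero] at hpos
    exact hpos.false
  refine ⟨signedSqrts F, signedSqrts G, by rw [card_signedSqrts, hF], by rw [card_signedSqrts, hG],
    fun x => ?_, fun x => ?_, √a, √b, sqrt_mem_signedSqrts ha, sqrt_mem_signedSqrts hb,
    fun t => le_sqrt_of_mem_signedSqrts hamax, fun t => le_sqrt_of_mem_signedSqrts hbmax,
    Real.sqrt_lt_sqrt (hGpos a ha).le hab⟩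
  · rw [prod_signedSqrts hFpos, ← hFprod, Peven_eq_eval_jacobi]
  · rw [prod_signedSqrts hGpos, ← hGprod, Peven_eq_eval_jacobi, Nat.cast_succ, add_right_comm]
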